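/- arXiv:math/0507394 — 11 statements merged into one kernel-verified Lean document; each statement's English description precedes it below -/
import Mathlib

section
/- Let (X,r) be a quadratic set. The following are equivalent: (1) (X,r) is a braided set; (2) conditions l1 and r2 hold; (3) conditions r1 and l2 hold. Moreover, for any quadratic set, l2 holds if and only if both l1 and lr3 hold, and r2 holds if and only if both r1 and lr3 hold. -/
/- Common framework for set-theoretic solutions of the Yang-Baxter equation
   (quadratic sets), following Gateva-Ivanova & Majid. -/

namespace YB

variable {X Y : Type*}

/-- Left action `^x y` : first component of `r (x, y)`. -/
def lact (r : X × X → X × X) (x y : X) : X := (r (x, y)).1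

/-- Right action `x ^ y` : second component of `r (x, y)`. -/
def ract (r : X × X → X × X) (x y : X) : X := (r (x, y)).2

def r12 (r : X × X → X × X) : X × X × X → X × X × X :=
  fun p => ((r (p.1, p.2.1)).1, (r (p.1, p.2.1)).2, p.2.2)

def r23 (r : X × X → X × X) : X × X × X → X × X × X :=
  fun p => (p.1, r (p.2.1, p.2.2))

/-- The Yang-Baxter equation (braided set condition). -/
def IsBraided (r : X × X → X × X) : Prop :=
  r12 r ∘ r23 r ∘ r12 r = r23 r ∘ r12 r ∘ r23 r

/-- l1 : `^x(^y z) = ^(^x y)(^(x^y) z)`. -/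
def CondL1 (r : X × X → X × X) : Prop :=
  ∀ x y z : X, lact r x (lact r y z) = lact r (lact r x y) (lact r (ract r x y) z)

/-- r1 : `(x^y)^z = (x^(^y z))^(y^z)`. -/
def CondR1 (r : X × X → X × X) : Prop :=
  ∀ x y z : X, ract r (ract r x y) z = ract r (ract r x (lact r y z)) (ract r y z)

/-- lr3 : `(^x y)^(^(x^y) z) = ^(x^(^y z))(y^z)`. -/
def CondLR3 (r : X × X → X × X) : Prop :=
  ∀ x y z : X,
    ract r (lact r x y) (lact r (ract r x y) z) =
      lact r (ract r x (lact r y z)) (ract r y z)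

/-- Extended left action on pairs : `^x (y,z) = (^x y, ^(x^y) z)`. -/
def lactPair (r : X × X → X × X) (x : X) (p : X × X) : X × X :=
  (lact r x p.1, lact r (ract r x p.1) p.2)

/-- Extended right action on pairs : `(x,y)^z = (x^(^y z), y^z)`. -/
def ractPair (r : X × X → X × X) (p : X × X) (z : X) : X × X :=
  (ract r p.1 (lact r p.2 z), ract r p.2 z)

/-- l2 : `r (^x (y,z)) = ^x (r (y,z))`. -/
def CondL2 (r : X × X → X × X) : Prop :=
  ∀ x y z : X, r (lactPair r x (y, z)) = lactPair r x (r (y, z))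

/-- r2 : `r ((x,y)^z) = (r (x,y))^z`. -/
def CondR2 (r : X × X → X × X) : Prop :=
  ∀ x y z : X, r (ractPair r (x, y) z) = ractPair r (r (x, y)) z

/-- Non-degeneracy: all left actions `L_x` and right actions `R_x` are bijective. -/
def Nondeg (r : X × X → X × X) : Prop :=
  (∀ x : X, Function.Bijective (lact r x)) ∧
    (∀ x : X, Function.Bijective fun y => ract r y x)

def SquareFree (r : X × X → X × X) : Prop := ∀ x : X, r (x, x) = (x, x)

/-- lri : `(^x y)^x = y = ^x (y^x)`. -/
def CondLRI (r : X × X → X × X) : Prop :=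
  ∀ x y : X, ract r (lact r x y) x = y ∧ lact r x (ract r y x) = y

/-- cl1 : `^(y^x) x = ^y x`. -/
def CondCL1 (r : X × X → X × X) : Prop := ∀ x y : X, lact r (ract r y x) x = lact r y x

/-- cr1 : `x^(^x y) = x^y`. -/
def CondCR1 (r : X × X → X × X) : Prop := ∀ x y : X, ract r x (lact r x y) = ract r x y

/-- cl2 : `^(^x y) x = ^y x`. -/
def CondCL2 (r : X × X → X × X) : Prop := ∀ x y : X, lact r (lact r x y) x = lact r y x

/-- cr2 : `x^(y^x) = x^y`. -/
def CondCR2 (r : X × X → X × X) : Prop := ∀ x y : X, ract r x (ract r y x) = ract r x y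

/-- cyclic : all four cyclic conditions. -/
def IsCyclic (r : X × X → X × X) : Prop := CondCL1 r ∧ CondCR1 r ∧ CondCL2 r ∧ CondCR2 r

/-- csl (left cycle set condition) : `^(^y t)(^y x) = ^(^t y)(^t x)`. -/
def CondCSL (r : X × X → X × X) : Prop :=
  ∀ x y t : X, lact r (lact r y t) (lact r y x) = lact r (lact r t y) (lact r t x)

/-- csr (right cycle set condition) : `(x^y)^(t^y) = (x^t)^(y^t)`. -/
def CondCSR (r : X × X → X × X) : Prop :=
  ∀ x y t : X, ract r (ract r x y) (ract r t y) = ract r (ract r x t) (ract r y t)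

def LeftTwoCancellative (r : X × X → X × X) : Prop :=
  ∀ k : ℕ, 1 ≤ k → ∀ x y z : X, r^[k] (x, y) = (x, z) → z = y

def RightTwoCancellative (r : X × X → X × X) : Prop :=
  ∀ k : ℕ, 1 ≤ k → ∀ x y t : X, r^[k] (x, y) = (t, y) → t = x

def TwoCancellative (r : X × X → X × X) : Prop :=
  LeftTwoCancellative r ∧ RightTwoCancellative r

/-- The defining relations `x y = (^x y)(x^y)` of the monoid `S(X,r)`. -/
def ybRel (r : X × X → X × X) : FreeMonoid X → FreeMonoid X → Prop :=
  fun a b => ∃ x y : X,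
    a = FreeMonoid.of x * FreeMonoid.of y ∧
      b = FreeMonoid.of (lact r x y) * FreeMonoid.of (ract r x y)

def ybCon (r : X × X → X × X) : Con (FreeMonoid X) := conGen (ybRel r)

/-- The monoid `S(X,r)` associated with a quadratic set. -/
abbrev YBM (r : X × X → X × X) := (ybCon r).Quotient

/-- The image in `S(X,r)` of a generator `x ∈ X`. -/
def gen (r : X × X → X × X) (x : X) : YBM r := (ybCon r).mk' (FreeMonoid.of x)

/-- Left cancellation on monomials of length 2 in `S(X,r)`. -/
def LeftCancel2 (r : X × X → X × X) : Prop :=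
  ∀ x y z : X, gen r x * gen r y = gen r x * gen r z → y = z

/-- Right cancellation on monomials of length 2 in `S(X,r)`. -/
def RightCancel2 (r : X × X → X × X) : Prop :=
  ∀ x y z : X, gen r y * gen r x = gen r z * gen r x → y = z

/-- Cancellation on monomials of length 3 in `S(X,r)`. -/
def Cancel3 (r : X × X → X × X) : Prop :=
  (∀ x y z p q : X,
      gen r x * gen r y * gen r z = gen r x * gen r p * gen r q →
        gen r y * gen r z = gen r p * gen r q) ∧
    (∀ x y z p q : X,
      gen r y * gen r z * gen r x = gen r p * gen r q * gen r x →
        gen r y * gen r z = gen r p * gen r q)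

/-- A matched pair structure `(S,S)` on a monoid `S` with the M3 property. -/
structure M3Structure (S : Type*) [Monoid S] where
  lact : S → S → S
  ract : S → S → S
  one_lact : ∀ v : S, lact 1 v = v
  mul_lact : ∀ u w v : S, lact (u * w) v = lact u (lact w v)
  ract_one : ∀ u : S, ract u 1 = u
  ract_mul : ∀ u v w : S, ract u (v * w) = ract (ract u v) w
  lact_one : ∀ u : S, lact u 1 = 1
  one_ract : ∀ v : S, ract 1 v = 1
  lact_mul : ∀ u v w : S, lact u (v * w) = lact u v * lact (ract u v) w
  mul_ract : ∀ u w v : S, ract (u * w) v = ract u (lact w v) * ract w v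
  m3 : ∀ u v : S, lact u v * ract u v = u * v

/-- The associated map `r_S (u,v) = (^u v, u^v)` of an M3-monoid. -/
def M3Structure.map {S : Type*} [Monoid S] (M : M3Structure S) : S × S → S × S :=
  fun p => (M.lact p.1 p.2, M.ract p.1 p.2)

/-- The map `σ (α, x) = (^α x, α^x)` built from a pair of ground actions. -/
def groundMap (gl : Y → X → X) (gr : Y → X → Y) : Y × X → X × Y :=
  fun p => (gl p.1 p.2, gr p.1 p.2)

/-- The regular extension `(Z, r)`, `Z = X ⊔ Y`, of `(X, rX)` and `(Y, rY)` along
ground actions `gl, gr` with `σinv` inverting `σ = groundMap gl gr`. -/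
def extMap (rX : X × X → X × X) (rY : Y × Y → Y × Y)
    (gl : Y → X → X) (gr : Y → X → Y) (σinv : X × Y → Y × X) :
    (X ⊕ Y) × (X ⊕ Y) → (X ⊕ Y) × (X ⊕ Y) :=
  fun p =>
    match p with
    | (Sum.inl x, Sum.inl y) => (Sum.inl (rX (x, y)).1, Sum.inl (rX (x, y)).2)
    | (Sum.inr a, Sum.inr b) => (Sum.inr (rY (a, b)).1, Sum.inr (rY (a, b)).2)
    | (Sum.inr a, Sum.inl x) => (Sum.inl (gl a x), Sum.inr (gr a x))
    | (Sum.inl x, Sum.inr a) => (Sum.inr (σinv (x, a)).1, Sum.inl (σinv (x, a)).2)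

/-- ml1 : `^α(^β x) = ^(^α β)(^(α^β) x)`. -/
def CondML1 (rY : Y × Y → Y × Y) (gl : Y → X → X) (gr : Y → X → Y) : Prop :=
  ∀ (α β : Y) (x : X), gl α (gl β x) = gl (lact rY α β) (gl (ract rY α β) x)

/-- mr1 : `(α^x)^y = (α^(^x y))^(x^y)`. -/
def CondMR1 (rX : X × X → X × X) (gr : Y → X → Y) : Prop :=
  ∀ (α : Y) (x y : X), gr (gr α x) y = gr (gr α (lact rX x y)) (ract rX x y)

/-- ml2 : `rX (^α (x,y)) = ^α (rX (x,y))`. -/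
def CondML2 (rX : X × X → X × X) (gl : Y → X → X) (gr : Y → X → Y) : Prop :=
  ∀ (α : Y) (x y : X),
    rX (gl α x, gl (gr α x) y) =
      (gl α (lact rX x y), gl (gr α (lact rX x y)) (ract rX x y))

/-- mr2 : `(rY (α,β))^x = rY ((α,β)^x)`. -/
def CondMR2 (rY : Y × Y → Y × Y) (gl : Y → X → X) (gr : Y → X → Y) : Prop :=
  ∀ (α β : Y) (x : X),
    (gr (lact rY α β) (gl (ract rY α β) x), gr (ract rY α β) x) =
      rY (gr α (gl β x), gr β x)

/-- ml1a : `^α(^x y) = ^(^α x)(^(α^x) y)`. -/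
def CondML1A (rX : X × X → X × X) (gl : Y → X → X) (gr : Y → X → Y) : Prop :=
  ∀ (α : Y) (x y : X),
    gl α (lact rX x y) = lact rX (gl α x) (gl (gr α x) y)

/-- mr1a : `(α^β)^x = (α^(^β x))^(β^x)`. -/
def CondMR1A (rY : Y × Y → Y × Y) (gl : Y → X → X) (gr : Y → X → Y) : Prop :=
  ∀ (α β : Y) (x : X),
    gr (ract rY α β) x = ract rY (gr α (gl β x)) (gr β x)


theorem aux_l2 {X : Type*} (r : X × X → X × X) : CondL2 r ↔ (CondL1 r ∧ CondLR3 r) := by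
  constructor
  · intro h
    exact ⟨fun x y z => (congrArg Prod.fst (h x y z)).symm,
      fun x y z => congrArg Prod.snd (h x y z)⟩
  · rintro ⟨h1, h2⟩ x y z
    exact Prod.ext (h1 x y z).symm (h2 x y z)

theorem aux_r2 {X : Type*} (r : X × X → X × X) : CondR2 r ↔ (CondR1 r ∧ CondLR3 r) := by
  constructor
  · intro h
    exact ⟨fun x y z => (congrArg Prod.snd (h x y z)).symm,
      fun x y z => (congrArg Prod.fst (h x y z)).symm⟩
  · rintro ⟨h1, h2⟩ x y z
    exact Prod.ext (h2 x y z).symm (h1 x y z).symm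

theorem aux_br {X : Type*} (r : X × X → X × X) :
    IsBraided r ↔ (CondL1 r ∧ CondR1 r ∧ CondLR3 r) := by
  constructor
  · intro h
    have h' := fun x y z => congrFun h (x, y, z)
    exact ⟨fun x y z => (congrArg Prod.fst (h' x y z)).symm,
      fun x y z => congrArg (fun p => p.2.2) (h' x y z),
      fun x y z => congrArg (fun p => p.2.1) (h' x y z)⟩
  · rintro ⟨h1, h2, h3⟩
    funext ⟨x, y, z⟩
    exact Prod.ext (h1 x y z).symm (Prod.ext (h3 x y z) (h2 x y z))

/-- Lemma 2.10: `(X,r)` is braided iff l1 & r2, iff r1 & l2;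
moreover for any quadratic set, l2 ⇔ l1 & lr3 and r2 ⇔ r1 & lr3. -/
theorem braided_iff_l1_r2_iff_r1_l2 {X : Type*} [Nonempty X]
    (r : X × X → X × X) (hr : Function.Bijective r) :
    (IsBraided r ↔ (CondL1 r ∧ CondR2 r)) ∧
      (IsBraided r ↔ (CondR1 r ∧ CondL2 r)) ∧
      (CondL2 r ↔ (CondL1 r ∧ CondLR3 r)) ∧
      (CondR2 r ↔ (CondR1 r ∧ CondLR3 r)) := by
  
  have h1 := aux_l2 r
  have h2 := aux_r2 r
  have h3 := aux_br r
  tauto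

end YB
end

section
/- Let (X,r) be a non-degenerate involutive quadratic set. Then r is 2-cancellative and the monoid S(X,r) has left and right cancellation on monomials of length 2. Furthermore, if (X,r) is in addition a braided set (a solution of the YBE), then S(X,r) has cancellation on monomials of length 3. -/
/- Common framework for set-theoretic solutions of the Yang-Baxter equation
   (quadratic sets), following Gateva-Ivanova & Majid. -/

namespace YB

variable {X Y : Type*}

def stp (r : X × X → X × X) (a b : List X) : Prop :=
  ∃ (u v : List X) (x y : X), a = u ++ x :: y :: v ∧ b = u ++ lact r x y :: ract r x y :: v

theorem stp_symm (r : X × X → X × X) (hinv : Function.Involutive r) 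
    (a b : List X) (h : stp r a b) : stp r b a := by
  obtain ⟨u, v, x, y, rfl, rfl⟩ := h
  have h := hinv (x, y)
  refine ⟨u, v, lact r x y, ract r x y, rfl, ?_⟩
  simp only [lact, ract, Prod.mk.eta, h]

theorem stp_left (r : X × X → X × X) (a b c : List X) (h : stp r a b) :
    stp r (c ++ a) (c ++ b) := by
  obtain ⟨u, v, x, y, rfl, rfl⟩ := h
  exact ⟨c ++ u, v, x, y, by simp, by simp⟩

theorem stp_right (r : X × X → X × X) (a b c : List X) (h : stp r a b) :
    stp r (a ++ c) (b ++ c) := by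
  obtain ⟨u, v, x, y, rfl, rfl⟩ := h
  exact ⟨u, v ++ c, x, y, by simp, by simp⟩

def stpCon (r : X × X → X × X) (hinv : Function.Involutive r) : Con (FreeMonoid X) where
  r a b := Relation.ReflTransGen (stp r) (FreeMonoid.toList a) (FreeMonoid.toList b)
  iseqv := ⟨fun _ => .refl, fun h =>
    (@Relation.ReflTransGen.stdSymm _ _ ⟨stp_symm r hinv⟩).symm _ _ h, fun h h' => h.trans h'⟩
  mul' := by
    intro a b c d h1 h2
    simp only [FreeMonoid.toList_mul]
    exact (Relation.ReflTransGen.lift (· ++ FreeMonoid.toList c)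
      (fun _ _ h => stp_right r _ _ _ h) _ _ h1).trans
      (Relation.ReflTransGen.lift (FreeMonoid.toList b ++ ·)
      (fun _ _ h => stp_left r _ _ _ h) _ _ h2)

theorem ybCon_stp (r : X × X → X × X) (hinv : Function.Involutive r) (a b : FreeMonoid X)
    (h : ybCon r a b) :
    Relation.ReflTransGen (stp r) (FreeMonoid.toList a) (FreeMonoid.toList b) := by
  have hle : ybCon r ≤ stpCon r hinv := by
    refine Con.conGen_le.2 ?_
    rintro _ _ ⟨x, y, rfl, rfl⟩
    exact Relation.ReflTransGen.single ⟨[], [], x, y, rfl, rfl⟩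
  exact hle h

theorem stp_two (r : X × X → X × X) (a b : X) (l : List X) (h : stp r [a, b] l) :
    l = [(r (a, b)).1, (r (a, b)).2] := by
  obtain ⟨u, v, x, y, h1, rfl⟩ := h
  rcases u with _ | ⟨u1, _ | ⟨u2, u⟩⟩ <;> simp_all [lact, ract]

def tl (w : X × X × X) : List X := [w.1, w.2.1, w.2.2]

theorem tl_inj (w w' : X × X × X) (h : tl w = tl w') : w = w' := by
  obtain ⟨a, b, c⟩ := w
  obtain ⟨a', b', c'⟩ := w'
  simpa [tl] using h

theorem stp_three (r : X × X → X × X) (w : X × X × X) (l : List X) (h : stp r (tl w) l) :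
    l = tl (r12 r w) ∨ l = tl (r23 r w) := by
  obtain ⟨a, b, c⟩ := w
  obtain ⟨u, v, x, y, h1, rfl⟩ := h
  rcases u with _ | ⟨u1, _ | ⟨u2, _ | ⟨u3, u⟩⟩⟩ <;> simp_all [lact, ract, tl, r12, r23]

theorem two_of_eq (r : X × X → X × X) (hinv : Function.Involutive r) (a b c d : X)
    (h : gen r a * gen r b = gen r c * gen r d) : (c, d) = (a, b) ∨ (c, d) = r (a, b) := by
  have h1 : ybCon r (FreeMonoid.of a * FreeMonoid.of b) (FreeMonoid.of c * FreeMonoid.of d) :=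
    (Con.eq _).1 h
  have h2 : Relation.ReflTransGen (stp r) [a, b] [c, d] := ybCon_stp r hinv _ _ h1
  have h3 : ∀ l, Relation.ReflTransGen (stp r) [a, b] l →
      l = [a, b] ∨ l = [(r (a, b)).1, (r (a, b)).2] := by
    intro l hl
    induction hl with
    | refl => exact Or.inl rfl
    | tail _ hs ih =>
      rcases ih with rfl | rfl
      · exact Or.inr (stp_two r _ _ _ hs)
      · left
        have := stp_two r _ _ _ hs
        simpa only [Prod.mk.eta, hinv (a, b)] using this
  rcases h3 _ h2 with h | h
  · left; simpa using h
  · right; ext <;> simp_all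

theorem three_of_eq (r : X × X → X × X) (hinv : Function.Involutive r) (hb : IsBraided r)
    (a b c a' b' c' : X)
    (h : gen r a * gen r b * gen r c = gen r a' * gen r b' * gen r c') :
    ∃ w w' : X × X × X, w = (a, b, c) ∧ w' = (a', b', c') ∧
    (w' = w ∨ w' = r12 r w ∨ w' = r23 r w ∨ w' = r23 r (r12 r w) ∨ w' = r12 r (r23 r w) ∨
      w' = r12 r (r23 r (r12 r w))) := by
  have h1 : ybCon r (FreeMonoid.of a * FreeMonoid.of b * FreeMonoid.of c)
      (FreeMonoid.of a' * FreeMonoid.of b' * FreeMonoid.of c') := (Con.eq _).1 h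
  have h2 : Relation.ReflTransGen (stp r) (tl (a, b, c)) (tl (a', b', c')) :=
    ybCon_stp r hinv _ _ h1
  refine ⟨_, _, rfl, rfl, ?_⟩
  generalize (a, b, c) = w at *
  generalize (a', b', c') = w' at *
  have e12 : ∀ w, r12 r (r12 r w) = w := by
    rintro ⟨a, b, c⟩
    simp [r12, hinv (a, b)]
  have e23 : ∀ w, r23 r (r23 r w) = w := by
    rintro ⟨a, b, c⟩
    simp [r23, hinv (b, c)]
  have eb : ∀ w, r23 r (r12 r (r23 r w)) = r12 r (r23 r (r12 r w)) := fun w =>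
    (congrFun hb w).symm
  have h3 : ∀ l, Relation.ReflTransGen (stp r) (tl w) l → ∃ w', l = tl w' ∧
     (w' = w ∨ w' = r12 r w ∨ w' = r23 r w ∨ w' = r23 r (r12 r w) ∨ w' = r12 r (r23 r w) ∨
      w' = r12 r (r23 r (r12 r w))) := by
    intro l hl
    induction hl with
    | refl => exact ⟨w, rfl, Or.inl rfl⟩
    | tail _ hs ih =>
      obtain ⟨w'', rfl, hw⟩ := ih
      rcases stp_three r _ _ hs with h | h
      · refine ⟨_, h, ?_⟩
        rcases hw with rfl | rfl | rfl | rfl | rfl | rfl <;> simp [e12]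
      · refine ⟨_, h, ?_⟩
        rcases hw with rfl | rfl | rfl | rfl | rfl | rfl <;> simp [e12, e23, eb]
  obtain ⟨w'', hw, h4⟩ := h3 _ h2
  rw [tl_inj _ _ hw]
  exact h4

theorem gen_mul (r : X × X → X × X) (x y : X) :
    gen r (r (x, y)).1 * gen r (r (x, y)).2 = gen r x * gen r y := by
  symm
  exact (Con.eq _).2 (ConGen.Rel.of _ _ ⟨x, y, rfl, rfl⟩)

theorem fix_left (r : X × X → X × X) (hnd : Nondeg r) (hinv : Function.Involutive r)
    (x y : X) (h : (r (x, y)).1 = x) : r (x, y) = (x, y) := by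
  have h1 : r (x, y) = (x, (r (x, y)).2) := Prod.ext h rfl
  have h2 : r (x, (r (x, y)).2) = (x, y) := by rw [← h1]; exact hinv _
  have h3 : (r (x, y)).2 = y := (hnd.1 x).1 (by simp only [lact]; rw [h2, h])
  rw [h1, h3]

theorem fix_right (r : X × X → X × X) (hnd : Nondeg r) (hinv : Function.Involutive r)
    (x y : X) (h : (r (x, y)).2 = y) : r (x, y) = (x, y) := by
  have h1 : r (x, y) = ((r (x, y)).1, y) := Prod.ext rfl h
  have h2 : r ((r (x, y)).1, y) = (x, y) := by rw [← h1]; exact hinv _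
  have h3 : (r (x, y)).1 = x := (hnd.2 y).1 (by simp only [ract]; rw [h2, h])
  rw [h1, h3]

theorem fix12 (r : X × X → X × X) (hnd : Nondeg r) (hinv : Function.Involutive r)
    (w : X × X × X) (h : (r12 r w).1 = w.1) : r12 r w = w := by
  obtain ⟨a, b, c⟩ := w
  have := fix_left r hnd hinv a b h
  simp [r12, this]

theorem fix23 (r : X × X → X × X) (hnd : Nondeg r) (hinv : Function.Involutive r)
    (w : X × X × X) (h : (r23 r w).2.2 = w.2.2) : r23 r w = w := by
  obtain ⟨a, b, c⟩ := w
  have := fix_right r hnd hinv b c h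
  simp [r23, this]

theorem iter_cases (r : X × X → X × X) (hinv : Function.Involutive r) (k : ℕ) (p : X × X) :
    r^[k] p = p ∨ r^[k] p = r p := by
  induction k with
  | zero => left; rfl
  | succ k ih =>
    rw [Function.iterate_succ_apply']
    rcases ih with h | h <;> rw [h]
    · right; rfl
    · left; exact hinv p

theorem cancel3_aux (r : X × X → X × X) (hnd : Nondeg r) (hinv : Function.Involutive r)
    (hb : IsBraided r) : Cancel3 r := by
  have e12 : ∀ w, r12 r (r12 r w) = w := by
    rintro ⟨a, b, c⟩
    simp [r12, hinv (a, b)]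
  have e23 : ∀ w, r23 r (r23 r w) = w := by
    rintro ⟨a, b, c⟩
    simp [r23, hinv (b, c)]
  have eb : ∀ w, r12 r (r23 r (r12 r w)) = r23 r (r12 r (r23 r w)) := fun w => congrFun hb w
  have f12 := fix12 r hnd hinv
  have f23 := fix23 r hnd hinv
  have g12 : ∀ w, (r12 r w).2.2 = w.2.2 := fun _ => rfl
  have g23 : ∀ w, (r23 r w).1 = w.1 := fun _ => rfl
  constructor
  · intro x y z p q h
    obtain ⟨w, w', hw, hw', h⟩ := three_of_eq r hinv hb _ _ _ _ _ _ h
    have h1 : w'.1 = w.1 := by rw [hw, hw']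
    have key : w' = w ∨ w' = r23 r w := by
      rcases h with h | h | h | h | h | h
      · exact Or.inl h
      · left; rw [h]; exact f12 _ (by rw [← h, h1])
      · exact Or.inr h
      · right; rw [h, f12 w (by rw [← g23 (r12 r w), ← h, h1])]
      · right; rw [h]; exact f12 _ (by rw [← h, h1, g23])
      · left
        rw [eb] at h
        rw [h, f12 (r23 r w) (by rw [← g23 (r12 r _), ← h, h1, g23]), e23]
    subst hw hw'
    rcases key with h | h
    · simp only [Prod.mk.injEq] at h
      rw [h.2.1, h.2.2]
    · simp only [r23, Prod.mk.injEq] at h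
      rw [← gen_mul r y z, ← h.2]
  · intro x y z p q h
    obtain ⟨w, w', hw, hw', h⟩ := three_of_eq r hinv hb _ _ _ _ _ _ h
    have h1 : w'.2.2 = w.2.2 := by rw [hw, hw']
    have key : w' = w ∨ w' = r12 r w := by
      rcases h with h | h | h | h | h | h
      · exact Or.inl h
      · exact Or.inr h
      · left; rw [h]; exact f23 _ (by rw [← h, h1])
      · right; rw [h]; exact f23 _ (by rw [← h, h1, g12])
      · right; rw [h, f23 w (by rw [← g12 (r23 r w), ← h, h1])]
      · left
        rw [h, f23 (r12 r w) (by rw [← g12 (r23 r _), ← h, h1, g12]), e12]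
    subst hw hw'
    rcases key with h | h
    · simp only [Prod.mk.injEq] at h
      rw [h.1, h.2.1]
    · simp only [r12, Prod.mk.injEq] at h
      rw [← gen_mul r y z, ← h.1, ← h.2.1]

/-- Corollary 2.24: a non-degenerate involutive quadratic set is
2-cancellative, `S(X,r)` cancels on monomials of length 2, and if `(X,r)` is
moreover braided then `S(X,r)` cancels on monomials of length 3. -/
theorem nondeg_involutive_cancellative {X : Type*} [Nonempty X]
    (r : X × X → X × X) (hr : Function.Bijective r)
    (hnd : Nondeg r) (hinv : Function.Involutive r) :
    TwoCancellative r ∧ LeftCancel2 r ∧ RightCancel2 r ∧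
      (IsBraided r → Cancel3 r) := by
  refine ⟨⟨?_, ?_⟩, ?_, ?_, cancel3_aux r hnd hinv⟩
  · intro k _ x y z h
    rcases iter_cases r hinv k (x, y) with h' | h' <;> rw [h'] at h
    · simpa using h.symm
    · rw [fix_left r hnd hinv x y (by rw [h])] at h
      simpa using h.symm
  · intro k _ x y z h
    rcases iter_cases r hinv k (x, y) with h' | h' <;> rw [h'] at h
    · simpa using h.symm
    · rw [fix_right r hnd hinv x y (by rw [h])] at h
      simpa using h.symm
  · intro x y z h
    rcases two_of_eq r hinv _ _ _ _ h with h | h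
    · simpa using h.symm
    · rw [fix_left r hnd hinv x y (by rw [← h])] at h
      simpa using h.symm
  · intro x y z h
    rcases two_of_eq r hinv _ _ _ _ h with h | h
    · simpa using h.symm
    · rw [fix_right r hnd hinv y x (by rw [← h])] at h
      simpa using h.symm

end YB
end

section
/- Let (X,r) be a quadratic set satisfying lri. Then the conditions cl1, cl2, cr1, cr2 are all equivalent to one another, and each of them is equivalent to (X,r) being cyclic (i.e. all four holding). -/
/- Common framework for set-theoretic solutions of the Yang-Baxter equation
   (quadratic sets), following Gateva-Ivanova & Majid. -/

namespace YB

variable {X Y : Type*}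

/-- Lemma 2.36: under lri, the conditions cl1, cl2, cr1, cr2 and
cyclicity are all equivalent. -/
theorem cyclic_conditions_tfae {X : Type*} [Nonempty X]
    (r : X × X → X × X) (hr : Function.Bijective r) (hlri : CondLRI r) :
    [CondCL1 r, CondCL2 r, CondCR1 r, CondCR2 r, IsCyclic r].TFAE := by
  have h1 : ∀ x y, ract r (lact r x y) x = y := fun x y => (hlri x y).1
  have h2 : ∀ x y, lact r x (ract r y x) = y := fun x y => (hlri x y).2
  have a12 : CondCL1 r → CondCL2 r := fun h x y => by
    have := h x (lact r x y)
    rw [h1] at this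
    exact this.symm
  have a21 : CondCL2 r → CondCL1 r := fun h x y => by
    have := h x (ract r y x)
    rw [h2] at this
    exact this.symm
  have a34 : CondCR1 r → CondCR2 r := fun h x y => by
    have := h x (ract r y x)
    rw [h2] at this
    exact this.symm
  have a43 : CondCR2 r → CondCR1 r := fun h x y => by
    have := h x (lact r x y)
    rw [h1] at this
    exact this.symm
  have a23 : CondCL2 r → CondCR1 r := fun h x y => by
    have e1 := h y (ract r x y)
    rw [h2] at e1
    have e2 := h (ract r x y) y
    rw [← e1, h2] at e2
    have e3 := h1 (lact r x y) (ract r x y)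
    rwa [e2] at e3
  have a41 : CondCR2 r → CondCL1 r := fun h x y => by
    have e1 := h y (lact r y x)
    rw [h1] at e1
    have e2 := h (lact r y x) y
    rw [← e1, h1] at e2
    have e3 := h2 (ract r y x) (lact r y x)
    rwa [e2] at e3
  tfae_have 1 → 2 := a12
  tfae_have 2 → 3 := a23
  tfae_have 3 → 4 := a34
  tfae_have 4 → 5 := fun h => ⟨a41 h, a43 h, a12 (a41 h), h⟩
  tfae_have 5 → 1 := fun h => h.1
  tfae_finish


end YB
end

section
/- Let (X,r) be a quadratic set. Any two of the following three conditions imply the remaining one: (1) r is involutive; (2) (X,r) is non-degenerate and cyclic; (3) lri holds. -/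
/- Common framework for set-theoretic solutions of the Yang-Baxter equation
   (quadratic sets), following Gateva-Ivanova & Majid. -/

namespace YB

variable {X Y : Type*}

/-- Proposition 2.37: each two of (1) `r` involutive,
(2) `(X,r)` non-degenerate and cyclic, (3) lri, imply the remaining one. -/
theorem involutive_cyclic_lri_two_imply_third {X : Type*} [Nonempty X]
    (r : X × X → X × X) (hr : Function.Bijective r) :
    ((Function.Involutive r ∧ (Nondeg r ∧ IsCyclic r)) → CondLRI r) ∧
      (((Nondeg r ∧ IsCyclic r) ∧ CondLRI r) → Function.Involutive r) ∧
      ((Function.Involutive r ∧ CondLRI r) → (Nondeg r ∧ IsCyclic r)) := by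
  have inv1 : Function.Involutive r → ∀ x y : X,
      lact r (lact r x y) (ract r x y) = x := fun h x y => congrArg Prod.fst (h (x, y))
  have inv2 : Function.Involutive r → ∀ x y : X,
      ract r (lact r x y) (ract r x y) = y := fun h x y => congrArg Prod.snd (h (x, y))
  refine ⟨?_, ?_, ?_⟩
  · rintro ⟨h, -, c1, c2, -, -⟩ x y
    constructor
    · have h1 := c2 (lact r x y) (ract r x y)
      rw [inv1 h, inv2 h] at h1
      exact h1
    · have h1 := c1 (ract r y x) (lact r y x)
      rw [inv1 h, inv2 h] at h1
      exact h1
  · rintro ⟨⟨-, c1, c2, c3, c4⟩, l⟩ ⟨x, y⟩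
    have e1 : lact r (lact r x y) (ract r x y) = x := by
      rw [← c1 y x, c3 (ract r x y) y]
      exact (l y x).2
    have e2 : ract r (lact r x y) (ract r x y) = y := by
      rw [← c2 (lact r x y) (ract r x y), e1]
      exact (l x y).1
    exact Prod.ext e1 e2
  · rintro ⟨h, l⟩
    have c1 : CondCL1 r := fun x y => by
      have h3 := (l (ract r y x) (lact r y x)).2
      rwa [inv2 h] at h3
    have c2 : CondCR1 r := fun x y => by
      have h3 := (l (lact r x y) (ract r x y)).1
      rwa [inv1 h] at h3
    refine ⟨⟨fun x => ?_, fun x => ?_⟩, c1, c2, fun x y => ?_, fun x y => ?_⟩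
    · exact Function.bijective_iff_has_inverse.2
        ⟨fun y => ract r y x, fun y => (l x y).1, fun y => (l x y).2⟩
    · exact Function.bijective_iff_has_inverse.2
        ⟨lact r x, fun y => (l x y).2, fun y => (l x y).1⟩
    · have h1 := c1 x (lact r x y)
      rw [(l x y).1] at h1
      exact h1.symm
    · have h1 := c2 x (ract r y x)
      rw [(l x y).2] at h1
      exact h1.symm


end YB
end

section
/- Let (X,r) be an involutive quadratic set satisfying lri. Then: (i) (X,r) is non-degenerate and cyclic; (ii) csl holds if and only if l1 holds; (iii) if csl holds then (^x z)^y = ^(x^y)(z^(y^x)) and ^x(z^y) = (^(^y x) z)^(^x y) for all x,y,z ∈ X; (iv) if in addition (X,r) is 2-cancellative and S(X,r) has cancellation on monomials of length 3, then csl ⇔ l1 ⇔ (X,r) is a symmetric set. -/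
/- Common framework for set-theoretic solutions of the Yang-Baxter equation
   (quadratic sets), following Gateva-Ivanova & Majid. -/

namespace YB

variable {X Y : Type*}

/-- Proposition 2.41: for an involutive quadratic set with lri:
(i) `(X,r)` is non-degenerate and cyclic; (ii) csl ⇔ l1;
(iii) csl implies `(^x z)^y = ^(x^y)(z^(y^x))` and `^x(z^y) = (^(^y x) z)^(^x y)`;
(iv) if moreover `(X,r)` is 2-cancellative and `S(X,r)` cancels on monomials of
length 3, then csl ⇔ l1 ⇔ symmetric set. -/
theorem involutive_lri_csl_l1 {X : Type*} [Nonempty X]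
    (r : X × X → X × X) (hr : Function.Bijective r)
    (hinv : Function.Involutive r) (hlri : CondLRI r) :
    (Nondeg r ∧ IsCyclic r) ∧
      (CondCSL r ↔ CondL1 r) ∧
      (CondCSL r →
        ∀ x y z : X,
          ract r (lact r x z) y =
              lact r (ract r x y) (ract r z (ract r y x)) ∧
            lact r x (ract r z y) =
              ract r (lact r (lact r y x) z) (lact r x y)) ∧
      (TwoCancellative r → Cancel3 r →
        ((CondCSL r ↔ CondL1 r) ∧
          (CondL1 r ↔ (IsBraided r ∧ Function.Involutive r)))) := by
  have h1 : ∀ x y, ract r (lact r x y) x = y := fun x y => (hlri x y).1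
  have h2 : ∀ x y, lact r x (ract r y x) = y := fun x y => (hlri x y).2
  have i1 : ∀ x y, lact r (lact r x y) (ract r x y) = x := fun x y =>
    congrArg Prod.fst (hinv (x, y))
  have i2 : ∀ x y, ract r (lact r x y) (ract r x y) = y := fun x y =>
    congrArg Prod.snd (hinv (x, y))
  have cr1 : ∀ x y, ract r x (lact r x y) = ract r x y := fun x y => by
    have := h1 (lact r x y) (ract r x y)
    rwa [i1] at this
  have cl1 : ∀ x y, lact r (ract r y x) x = lact r y x := fun x y => by
    have := h2 (ract r y x) (lact r y x)
    rwa [i2] at this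
  have cl2 : ∀ x y, lact r (lact r x y) x = lact r y x := fun x y => by
    have := cl1 x (lact r x y)
    rw [h1] at this
    exact this.symm
  have cr2 : ∀ x y, ract r x (ract r y x) = ract r x y := fun x y => by
    have := cr1 x (ract r y x)
    rw [h2] at this
    exact this.symm
  have hiff : CondCSL r ↔ CondL1 r := by
    constructor
    · intro h x y z
      have := h z (ract r x y) y
      rw [h2, cl1] at this
      exact this.symm
    · intro h x y t
      have := h (lact r t y) t x
      rw [cl2, h1] at this
      exact this.symm
  have hb : CondL1 r → IsBraided r := by
    intro h
    funext ⟨x, y, z⟩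
    have e1 := h x y z
    have e2 : ract r (ract r x y) z = ract r (ract r x (lact r y z)) (ract r y z) := by
      have := h y z (ract r (ract r x (lact r y z)) (ract r y z))
      rw [h2, h2] at this
      have h5 := congrArg (fun w => ract r (ract r w y) z) this
      simp only [h1] at h5
      exact h5.symm
    have e3 : ract r (lact r x y) (lact r (ract r x y) z) =
        lact r (ract r x (lact r y z)) (ract r y z) := by
      have := h x (lact r y z) (ract r y z)
      rw [i1] at this
      have h4 := h1 (lact r x (lact r y z)) (lact r (ract r x (lact r y z)) (ract r y z))
      rw [← this, e1, cr1] at h4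
      exact h4
    exact Prod.ext e1.symm (Prod.ext e3 e2)
  refine ⟨⟨⟨fun x => ?_, fun x => ?_⟩, cl1, cr1, cl2, cr2⟩, hiff, ?_, ?_⟩
  · exact Function.bijective_iff_has_inverse.2 ⟨fun y => ract r y x, h1 x, h2 x⟩
  · exact Function.bijective_iff_has_inverse.2 ⟨lact r x, h2 x, h1 x⟩
  · intro h x y z
    constructor
    · have := hiff.1 h x (ract r y x) (ract r z (ract r y x))
      rw [h2, h2, cr2] at this
      rw [this, h1]
    · have := h (ract r z y) x y
      rw [h2] at this
      rw [← this, h1]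
  · intro _ _
    refine ⟨hiff, fun h => ⟨hb h, hinv⟩, fun h x y z => ?_⟩
    exact (congrArg Prod.fst (congrFun h.1 (x, y, z))).symm

end YB
end

section
/- Let (X,r) be a non-degenerate square-free quadratic set. Then: l1 implies cl1; r1 implies cr1; lr3 implies both cl1 and cr1; csl implies cl2; and csr implies cr2. -/
/- Common framework for set-theoretic solutions of the Yang-Baxter equation
   (quadratic sets), following Gateva-Ivanova & Majid. -/

namespace YB

variable {X Y : Type*}

/-- Lemma 2.43: for a non-degenerate square-free quadratic set:
l1 ⟹ cl1, r1 ⟹ cr1, lr3 ⟹ cl1 & cr1, csl ⟹ cl2, csr ⟹ cr2. -/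
theorem squarefree_cyclic_implications {X : Type*} [Nonempty X]
    (r : X × X → X × X) (hr : Function.Bijective r)
    (hnd : Nondeg r) (hsf : SquareFree r) :
    (CondL1 r → CondCL1 r) ∧
      (CondR1 r → CondCR1 r) ∧
      (CondLR3 r → CondCL1 r ∧ CondCR1 r) ∧
      (CondCSL r → CondCL2 r) ∧
      (CondCSR r → CondCR2 r) := by
  have hl : ∀ x, lact r x x = x := fun x => by simp [lact, hsf x]
  have hrr : ∀ x, ract r x x = x := fun x => by simp [ract, hsf x]
  refine ⟨fun h x y => ?_, fun h x y => ?_, fun h => ⟨fun x y => ?_, fun x y => ?_⟩,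
    fun h x y => ?_, fun h x y => ?_⟩
  · have e := h y x x
    rw [hl x] at e
    exact (hnd.1 (lact r y x)).1 (e.symm.trans (hl _).symm)
  · have e := h x x y
    rw [hrr x] at e
    exact (hnd.2 (ract r x y)).1 (e.symm.trans (hrr _).symm)
  · have e := h y x x
    rw [hl x, hrr x] at e
    exact ((hnd.2 (lact r (ract r y x) x)).1 (e.trans (hrr _).symm)).symm
  · have e := h x x y
    rw [hl x, hrr x] at e
    exact (hnd.1 (ract r x (lact r x y))).1 ((hl _).trans ((hrr _).symm.trans (by rw [hrr]; exact e)))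
  · have e := h x x y
    rwa [hl x, hl] at e
  · have e := h x x y
    rwa [hrr x, hrr] at e

end YB
end

section
/- Let (X,r) be a non-degenerate square-free quadratic set satisfying at least one of the conditions l1, r1, lr3, csl, csr. Then r is involutive if and only if lri holds; and in this case (X,r) is cyclic. -/
/- Common framework for set-theoretic solutions of the Yang-Baxter equation
   (quadratic sets), following Gateva-Ivanova & Majid. -/

namespace YB

variable {X Y : Type*}

section Core

theorem core_inv (f g : X → X → X) (hf : ∀ x y z, f x y = f x z → y = z)
    (hg : ∀ x y z, g y x = g z x → y = z)
    (i1 : ∀ x y, f (f x y) (g x y) = x) (i2 : ∀ x y, g (f x y) (g x y) = y)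
    (h : (∀ x y, f (g y x) x = f y x) ∨ (∀ x y, f (f x y) x = f y x)) :
    (∀ x y, g (f x y) x = y ∧ f x (g y x) = y) ∧ (∀ x y, f (g y x) x = f y x) ∧
      (∀ x y, g x (f x y) = g x y) ∧ (∀ x y, f (f x y) x = f y x) ∧
      (∀ x y, g x (g y x) = g x y) := by
  have lri : ∀ x y, g (f x y) x = y ∧ f x (g y x) = y := by
    rcases h with c | c
    · have k : ∀ x y, f x (g y x) = y := by
        intro x y
        have := c (g y x) (f y x)
        rw [i2, i1] at this
        exact this
      exact fun x y => ⟨hf x _ _ (k _ _), k _ _⟩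
    · have k : ∀ y x, g (f y x) y = x := by
        intro y x
        have h1 : f (f x y) x = f y x := c x y
        have h2 : f (f y x) y = f x y := c y x
        have h3 : g (f x y) x = y := by
          apply hf (f y x)
          rw [h2]
          have := i1 (f x y) x
          rw [h1] at this
          exact this
        have h4 := i2 (f x y) x
        rw [h1, h3] at h4
        exact h4
      exact fun x y => ⟨k _ _, hg x _ _ (k _ _)⟩
  have cl1 : ∀ x y, f (g y x) x = f y x := by
    rcases h with c | c
    · exact c
    · intro x y
      have := c x (g y x)
      rw [(lri x y).2] at this
      exact this.symm
  have cl2 : ∀ x y, f (f x y) x = f y x := by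
    intro x y
    have := cl1 x (f x y)
    rw [(lri x y).1] at this
    exact this.symm
  have cr1 : ∀ x y, g x (f x y) = g x y := by
    intro x y
    apply hf (f x y)
    rw [(lri (f x y) x).2, i1]
  have cr2 : ∀ x y, g x (g y x) = g x y := by
    intro x y
    have := cr1 x (g y x)
    rw [(lri x y).2] at this
    exact this.symm
  exact ⟨lri, cl1, cr1, cl2, cr2⟩

theorem core_lri (f g : X → X → X)
    (lri : ∀ x y, g (f x y) x = y ∧ f x (g y x) = y)
    (h : (∀ x y, f (g y x) x = f y x) ∨ (∀ x y, f (f x y) x = f y x)) :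
    (∀ x y, f (f x y) (g x y) = x) ∧ (∀ x y, g (f x y) (g x y) = y) := by
  have cl1 : ∀ x y, f (g y x) x = f y x := by
    rcases h with c | c
    · exact c
    · intro x y
      have := c x (g y x)
      rw [(lri x y).2] at this
      exact this.symm
  have cl2 : ∀ x y, f (f x y) x = f y x := by
    intro x y
    have := cl1 x (f x y)
    rw [(lri x y).1] at this
    exact this.symm
  refine ⟨fun x y => ?_, fun x y => ?_⟩
  · rw [← cl1 y x, cl2, (lri y x).2]
  · rw [← cl1 y x, (lri _ _).1]

end Core

/-- Corollary 2.44: for a non-degenerate square-free quadratic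
set satisfying one of l1, r1, lr3, csl, csr: `r` is involutive iff lri; and in
this case `(X,r)` is cyclic. -/
theorem squarefree_involutive_iff_lri {X : Type*} [Nonempty X]
    (r : X × X → X × X) (hr : Function.Bijective r)
    (hnd : Nondeg r) (hsf : SquareFree r)
    (hone : CondL1 r ∨ CondR1 r ∨ CondLR3 r ∨ CondCSL r ∨ CondCSR r) :
    (Function.Involutive r ↔ CondLRI r) ∧
      (Function.Involutive r → IsCyclic r) := by
  have hf : ∀ x y z, lact r x y = lact r x z → y = z := fun x y z h => (hnd.1 x).1 h
  have hg : ∀ x y z, ract r y x = ract r z x → y = z := fun x y z h => (hnd.2 x).1 h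
  have sf : ∀ x, lact r x x = x := fun x => by simp [lact, hsf x]
  have sg : ∀ x, ract r x x = x := fun x => by simp [ract, hsf x]
  have hinv : Function.Involutive r ↔
      (∀ x y, lact r (lact r x y) (ract r x y) = x) ∧
      (∀ x y, ract r (lact r x y) (ract r x y) = y) := by
    constructor
    · intro h
      refine ⟨fun x y => ?_, fun x y => ?_⟩
      · exact congrArg Prod.fst (h (x, y))
      · exact congrArg Prod.snd (h (x, y))
    · rintro ⟨h1, h2⟩ ⟨x, y⟩
      exact Prod.ext (h1 x y) (h2 x y)
  have key : (CondCL1 r ∨ CondCL2 r) ∨ (CondCR1 r ∨ CondCR2 r) := by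
    rcases hone with h | h | h | h | h
    · left; left
      intro y x
      have := h x y y
      rw [sf] at this
      exact hf (lact r x y) _ _ (this.symm.trans (sf _).symm)
    · right; left
      intro x z
      have := h x x z
      rw [sg] at this
      exact hg (ract r x z) _ _ (this.symm.trans (sg _).symm)
    · right; left
      intro x z
      have := h x x z
      rw [sf, sg] at this
      exact (hf _ _ _ (this.symm.trans (sf _).symm)).symm
    · left; right
      intro y t
      have := h y y t
      rw [sf, sf] at this
      exact this
    · right; right
      intro y t
      have := h y y t
      rw [sg, sg] at this
      exact this
  have main : Function.Involutive r → CondLRI r ∧ IsCyclic r := by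
    intro hi
    obtain ⟨i1, i2⟩ := hinv.1 hi
    rcases key with k | k
    · obtain ⟨a, b⟩ := core_inv (lact r) (ract r) hf hg i1 i2 k
      exact ⟨a, b⟩
    · obtain ⟨a, b1, b2, b3, b4⟩ := core_inv (fun x y => ract r y x) (fun x y => lact r y x)
        hg hf (fun x y => i2 y x) (fun x y => i1 y x) k
      exact ⟨fun x y => ⟨(a x y).2, (a x y).1⟩, b2, b1, b4, b3⟩
  refine ⟨⟨fun h => (main h).1, fun h => hinv.2 ?_⟩, fun h => (main h).2⟩
  rcases key with k | k
  · exact core_lri (lact r) (ract r) h k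
  · obtain ⟨a, b⟩ := core_lri (fun x y => ract r y x) (fun x y => lact r y x)
      (fun x y => ⟨(h x y).2, (h x y).1⟩) k
    exact ⟨fun x y => b y x, fun x y => a y x⟩

end YB
end

section
/- Let (X,r) be a non-degenerate, involutive, square-free quadratic set (a quantum binomial set) satisfying condition lr3. Then (X,r) is a symmetric set, and lri holds. -/
/- Common framework for set-theoretic solutions of the Yang-Baxter equation
   (quadratic sets), following Gateva-Ivanova & Majid. -/

namespace YB

variable {X Y : Type*}

/-- Lemma 2.45: a quantum binomial set (non-degenerate,
involutive, square-free) satisfying lr3 is a symmetric set with lri. -/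
theorem quantum_binomial_lr3_symmetric {X : Type*} [Nonempty X]
    (r : X × X → X × X) (hr : Function.Bijective r)
    (hnd : Nondeg r) (hinv : Function.Involutive r) (hsf : SquareFree r)
    (hlr3 : CondLR3 r) :
    (IsBraided r ∧ Function.Involutive r) ∧ CondLRI r := by
  have i1 : ∀ x y, lact r (lact r x y) (ract r x y) = x := fun x y =>
    congrArg Prod.fst (hinv (x, y))
  have i2 : ∀ x y, ract r (lact r x y) (ract r x y) = y := fun x y =>
    congrArg Prod.snd (hinv (x, y))
  have s1 : ∀ x, lact r x x = x := fun x => congrArg Prod.fst (hsf x)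
  have s2 : ∀ x, ract r x x = x := fun x => congrArg Prod.snd (hsf x)
  have injL : ∀ x y z, lact r x y = lact r x z → y = z := fun x y z h => (hnd.1 x).1 h
  have injR : ∀ x y z, ract r y x = ract r z x → y = z := fun x y z h => (hnd.2 x).1 h
  have cl1 : ∀ x y, lact r x y = lact r (ract r x y) y := by
    intro x y
    have h := hlr3 x y y
    rw [s1, s2] at h
    exact injR _ _ _ (h.trans (s2 _).symm)
  have cr1 : ∀ y z, ract r y (lact r y z) = ract r y z := by
    intro y z
    have h := hlr3 y y z
    rw [s1, s2] at h
    exact injL _ _ _ ((s1 _).trans h)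
  have inv12 : ∀ u, r12 r (r12 r u) = u := by
    rintro ⟨x, y, z⟩
    exact Prod.ext (i1 x y) (Prod.ext (i2 x y) rfl)
  have inv23 : ∀ u, r23 r (r23 r u) = u := by
    rintro ⟨x, y, z⟩
    exact Prod.ext rfl (Prod.ext (i1 y z) (i2 y z))
  have key : ∀ u, (r12 r (r23 r (r12 r u))).2.1 = (r23 r (r12 r (r23 r u))).2.1 := by
    rintro ⟨x, y, z⟩
    exact hlr3 x y z
  have cA : ∀ u v : X × X × X, u.2.1 = v.2.1 → (r12 r u).2.1 = (r12 r v).2.1 → u.1 = v.1 := by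
    rintro ⟨a, m, b⟩ ⟨a', m', b'⟩ h h2
    obtain rfl : m = m' := h
    exact injR m a a' h2
  have cB : ∀ u v : X × X × X, u.2.1 = v.2.1 → (r23 r u).2.1 = (r23 r v).2.1 → u.2.2 = v.2.2 := by
    rintro ⟨a, m, b⟩ ⟨a', m', b'⟩ h h2
    obtain rfl : m = m' := h
    exact injL m b b' h2
  refine ⟨⟨?_, hinv⟩, ?_⟩
  · funext u
    change r12 r (r23 r (r12 r u)) = r23 r (r12 r (r23 r u))
    refine Prod.ext (cA _ _ (key u) ?_) (Prod.ext (key u) (cB _ _ (key u) ?_))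
    · have h := key (r23 r u)
      rw [inv23] at h
      rw [inv12, h]
    · have h := key (r12 r u)
      rw [inv12] at h
      rw [inv23, h]
  · intro x y
    constructor
    · have h := cr1 (lact r x y) (ract r x y)
      rwa [i1, i2] at h
    · have h := cl1 (lact r y x) (ract r y x)
      rw [i1, i2] at h
      exact h.symm

end YB
end

section
/- Let (X,r) be a non-degenerate, square-free, involutive quadratic set. Then (X,r) is a symmetric set if and only if csl holds. In this case (X,r) is cyclic and satisfies lri. -/
/- Common framework for set-theoretic solutions of the Yang-Baxter equation
   (quadratic sets), following Gateva-Ivanova & Majid. -/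

namespace YB

variable {X Y : Type*}

theorem invol1 {r : X × X → X × X} (h : Function.Involutive r) (x y : X) :
    lact r (lact r x y) (ract r x y) = x := congrArg Prod.fst (h (x, y))

theorem braided_iff (r : X × X → X × X) :
    IsBraided r ↔ CondL1 r ∧ CondR1 r ∧ CondLR3 r := by
  constructor
  · intro h
    have h' : ∀ x y z : X, _ := fun x y z => congrFun h (x, y, z)
    simp only [Function.comp, r12, r23, Prod.ext_iff] at h'
    exact ⟨fun x y z => (h' x y z).1.symm, fun x y z => (h' x y z).2.2,
      fun x y z => (h' x y z).2.1⟩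
  · rintro ⟨h1, h2, h3⟩
    funext ⟨x, y, z⟩
    exact Prod.ext (h1 x y z).symm (Prod.ext (h3 x y z) (h2 x y z))

theorem lri_of_cl2 {r : X × X → X × X} (hnd : Nondeg r) (hinv : Function.Involutive r)
    (hc : CondCL2 r) : CondLRI r := by
  have key : ∀ y x, lact r y (ract r x y) = x := by
    intro y x
    obtain ⟨z, rfl⟩ := (hnd.1 y).2 x
    have e : lact r (lact r (lact r y z) y) z = lact r y z := by
      rw [hc y z, hc z y]
    have := (hnd.1 _).1 ((invol1 hinv (lact r y z) y).trans e.symm)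
    rw [this]
  exact fun x y => ⟨(hnd.1 x).1 (key x _), key x y⟩

theorem cyc_of_l1 {r : X × X → X × X} (hnd : Nondeg r) (hsf : SquareFree r)
    (hinv : Function.Involutive r) (h1 : CondL1 r) : IsCyclic r ∧ CondLRI r := by
  have sq : ∀ x, lact r x x = x := fun x => congrArg Prod.fst (hsf x)
  have cl1 : CondCL1 r := by
    intro x y
    have := h1 y x x
    rw [sq] at this
    exact ((hnd.1 _).1 ((sq _).trans this)).symm
  have key : ∀ y x, lact r y (ract r x y) = x := by
    intro y x
    -- `L_x L_y u = L_(L_x y) (L_(x^y) u)`, with `L_y u = x`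
    obtain ⟨u, hu⟩ := (hnd.1 y).2 x
    have a := h1 x y u
    rw [hu, sq] at a
    have b : lact r (ract r x y) u = ract r x y :=
      (hnd.1 _).1 (a.symm.trans (invol1 hinv x y).symm)
    have c : u = ract r x y := (hnd.1 _).1 (b.trans (sq _).symm)
    rw [← c, hu]
  have lri : CondLRI r := fun x y => ⟨(hnd.1 x).1 (key x _), key x y⟩
  have cl2 : CondCL2 r := by
    intro x y
    have := cl1 x (lact r x y)
    rw [(lri x y).1] at this
    exact this.symm
  have cr1 : CondCR1 r := by
    intro x y
    apply (hnd.1 (lact r x y)).1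
    rw [key, invol1 hinv]
  refine ⟨⟨cl1, cr1, cl2, ?_⟩, lri⟩
  intro x y
  have := cr1 x (ract r y x)
  rw [key] at this
  exact this.symm

theorem csl_of_l1 {r : X × X → X × X} (hnd : Nondeg r) (hsf : SquareFree r)
    (hinv : Function.Involutive r) (h1 : CondL1 r) : CondCSL r := by
  obtain ⟨⟨-, -, cl2, -⟩, lri⟩ := cyc_of_l1 hnd hsf hinv h1
  intro x y t
  rw [h1 (lact r y t) y x, (lri y t).1, cl2]

theorem braided_of_csl {r : X × X → X × X} (hnd : Nondeg r) (hsf : SquareFree r)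
    (hinv : Function.Involutive r) (h : CondCSL r) : IsBraided r := by
  have sq : ∀ x, lact r x x = x := fun x => congrArg Prod.fst (hsf x)
  have cl2 : CondCL2 r := by
    intro t y
    have := h t y t
    rw [sq, sq] at this
    exact this.symm
  have lri := lri_of_cl2 hnd hinv cl2
  have h1 : CondL1 r := by
    intro x y z
    obtain ⟨u, rfl⟩ := (hnd.1 y).2 x
    rw [(lri y u).1, cl2, h]
  refine (braided_iff r).2 ⟨h1, ?_, ?_⟩
  · intro x y z
    apply (hnd.1 z).1
    apply (hnd.1 y).1
    rw [(lri z _).2, (lri y _).2, h1 y z, (lri _ _).2, (lri _ _).2]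
  · intro x y z
    apply (hnd.1 (lact r x (lact r y z))).1
    rw [← h1 x (lact r y z), invol1 hinv, h1 x y z, invol1 hinv]

/-- Corollary 2.46: a non-degenerate square-free involutive
quadratic set is a symmetric set iff csl holds; in this case it is cyclic and
satisfies lri. -/
theorem squarefree_symmetric_iff_csl {X : Type*} [Nonempty X]
    (r : X × X → X × X) (hr : Function.Bijective r)
    (hnd : Nondeg r) (hsf : SquareFree r) (hinv : Function.Involutive r) :
    ((IsBraided r ∧ Function.Involutive r) ↔ CondCSL r) ∧
      ((IsBraided r ∧ Function.Involutive r) → (IsCyclic r ∧ CondLRI r)) := by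
  exact ⟨⟨fun h => csl_of_l1 hnd hsf hinv ((braided_iff r).1 h.1).1,
      fun h => ⟨braided_of_csl hnd hsf hinv h, hinv⟩⟩,
    fun h => cyc_of_l1 hnd hsf hinv ((braided_iff r).1 h.1).1⟩

end YB
end

section
/- Let (X,r) be a non-degenerate, involutive, square-free quadratic set (a quantum binomial set). The following conditions are equivalent: (1) (X,r) is a set-theoretic solution of the Yang–Baxter equation (a braided set); (2) l1; (3) l2; (4) r1; (5) r2; (6) lr3; (7) csl. In this case (X,r) is cyclic and satisfies lri. -/
/- Common framework for set-theoretic solutions of the Yang-Baxter equation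
   (quadratic sets), following Gateva-Ivanova & Majid. -/

namespace YB

variable {X Y : Type*}

section Aux

theorem aux_l1 {l s : X → X → X} (h1 : ∀ x y, l (l x y) (s x y) = x)
    (li : ∀ x a b, l x a = l x b → a = b)
    (hl : ∀ x y z, l x (l y z) = l (l x y) (l (s x y) z)) :
    (∀ x y z, s (l x y) (l (s x y) z) = l (s x (l y z)) (s y z)) ∧
    (∀ x y z, s (s x y) z = s (s x (l y z)) (s y z)) := by
  have h3 : ∀ x y z, s (l x y) (l (s x y) z) = l (s x (l y z)) (s y z) := by
    intro x y z
    apply li (l x (l y z))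
    rw [← hl x (l y z) (s y z), h1 y z, hl x y z, h1]
  refine ⟨h3, fun x y z => ?_⟩
  apply li (l (s x y) z)
  apply li (l x y)
  rw [h1, h1, hl (l x y) (l (s x y) z), h3, ← hl x y z, h1, h1]

theorem aux_lri {l s : X → X → X} (h1 : ∀ x y, l (l x y) (s x y) = x)
    (li : ∀ x a b, l x a = l x b → a = b) (sq : ∀ x, l x x = x)
    (hl : ∀ x y z, l x (l y z) = l (l x y) (l (s x y) z)) :
    (∀ x y, l y (s x y) = x) ∧ (∀ x y, l (s x y) y = l x y) := by
  constructor
  · intro x y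
    apply li x
    rw [hl, sq, h1, sq]
  · intro x y
    apply li (l x y)
    rw [← hl, sq, sq]

theorem aux_csl_lri {l s : X → X → X} (h1 : ∀ x y, l (l x y) (s x y) = x)
    (li : ∀ x a b, l x a = l x b → a = b) (ls : ∀ x b, ∃ a, l x a = b)
    (cl2 : ∀ x y, l (l x y) x = l y x) : ∀ x y, l y (s x y) = x := by
  intro x y
  obtain ⟨w, hw⟩ := ls y x
  have e : l x y = l w y := by rw [← hw, cl2]
  have e2 : l (l x y) w = x := by rw [e, cl2, hw]
  have : s x y = w := li (l x y) _ _ (by rw [h1, e2])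
  rw [this, hw]

theorem aux_csl {l s : X → X → X}
    (a1 : ∀ x y, l y (s x y) = x) (a2 : ∀ x y, s (l y x) y = x)
    (cl2 : ∀ x y, l (l x y) x = l y x) :
    (∀ x y t, l (l y t) (l y x) = l (l t y) (l t x)) ↔
    (∀ x y z, s (s x y) z = s (s x (l y z)) (s y z)) := by
  constructor
  · intro h x y z
    have e := h (s (s x y) z) z (s y z)
    have e2 : l (s y z) z = l y z := by
      have := cl2 z (s y z)
      rw [a1] at this
      exact this.symm
    rw [a1, a1, a1, e2] at e
    conv_rhs => rw [e]
    rw [a2, a2]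
  · intro h x y t
    have e := h (l (l y t) (l y x)) (l y t) y
    rw [a2, a2, cl2, a2] at e
    conv_rhs => rw [e, a1, a1]

theorem aux_lr3 {l s : X → X → X} (h1 : ∀ x y, l (l x y) (s x y) = x)
    (li : ∀ x a b, l x a = l x b → a = b) (ls : ∀ x b, ∃ a, l x a = b)
    (si : ∀ x a b, s a x = s b x → a = b)
    (sq : ∀ x, l x x = x) (sq' : ∀ x, s x x = x)
    (h3 : ∀ x y z, s (l x y) (l (s x y) z) = l (s x (l y z)) (s y z)) :
    ∀ x y z, l x (l y z) = l (l x y) (l (s x y) z) := by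
  have cl1 : ∀ x y, l (s x y) y = l x y := by
    intro x y
    have e := h3 x y y
    rw [sq, sq'] at e
    exact (si _ _ _ (e.trans (sq' _).symm)).symm
  have cr1 : ∀ x y, s x (l x y) = s x y := by
    intro x y
    have e := h3 x x y
    rw [sq, sq'] at e
    have e2 : s x (l x y) = l (s x (l x y)) (s x y) := e
    exact li _ _ _ ((sq _).trans e2)
  have a1 : ∀ x y, l y (s x y) = x := by
    intro x y
    obtain ⟨w, rfl⟩ := ls x y
    rw [cr1, h1]
  have a2 : ∀ x y, s (l y x) y = x := fun x y => li y _ _ (a1 _ _)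
  have cl2 : ∀ x y, l (l x y) x = l y x := by
    intro x y
    have := cl1 (l x y) x
    rw [a2] at this
    exact this.symm
  have key : ∀ m z q, l m (l z q) = l (l m z) (l (s (l (l z q) m) (l q z)) q) := by
    intro m z q
    have e := h3 (l (l z q) m) (l z q) z
    rw [a2, cl2, a2, cl2] at e
    rw [← e, a1]
  intro m z q
  have k1 := key m z q
  have k2 := key (l z q) z (s m z)
  rw [a1, cl2] at k2
  have cs : l (s m z) z = l m z := cl1 m z
  rw [cs, k1, a2] at k2
  have k3 : s (l (l z q) m) (l q z) = l (l (s (l (l z q) m) (l q z)) q) (s m z) := by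
    conv_lhs => rw [k2]
    rw [a2]
  rw [k1]
  congr 1
  generalize s (l (l z q) m) (l q z) = p at *
  have c := cr1 (l p q) (s m z)
  rw [← k3, a2] at c
  conv_rhs => rw [c, a1]

end Aux

/-- Theorem 2.48: for a quantum binomial set (non-degenerate,
involutive, square-free), the conditions braided, l1, l2, r1, r2, lr3 and csl
are all equivalent, and in this case `(X,r)` is cyclic with lri. -/
theorem quantum_binomial_tfae {X : Type*} [Nonempty X]
    (r : X × X → X × X) (hr : Function.Bijective r)
    (hnd : Nondeg r) (hinv : Function.Involutive r) (hsf : SquareFree r) :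
    ([IsBraided r, CondL1 r, CondL2 r, CondR1 r, CondR2 r, CondLR3 r,
        CondCSL r].TFAE) ∧
      (IsBraided r → (IsCyclic r ∧ CondLRI r)) := by
  obtain ⟨hL, hR⟩ := hnd
  have h1 : ∀ x y, lact r (lact r x y) (ract r x y) = x := fun x y =>
    congrArg Prod.fst (hinv (x, y))
  have h2 : ∀ x y, ract r (lact r x y) (ract r x y) = y := fun x y =>
    congrArg Prod.snd (hinv (x, y))
  have li : ∀ x a b, lact r x a = lact r x b → a = b := fun x a b h => (hL x).1 h
  have ls : ∀ x b, ∃ a, lact r x a = b := fun x => (hL x).2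
  have si : ∀ x a b, ract r a x = ract r b x → a = b := fun x a b h => (hR x).1 h
  have sq : ∀ x, lact r x x = x := fun x => congrArg Prod.fst (hsf x)
  have sq' : ∀ x, ract r x x = x := fun x => congrArg Prod.snd (hsf x)
  have hB : IsBraided r ↔ CondL1 r ∧ CondLR3 r ∧ CondR1 r := by
    constructor
    · intro h
      have h' := fun x y z => congrFun h (x, y, z)
      refine ⟨fun x y z => ?_, fun x y z => ?_, fun x y z => ?_⟩
      · exact (congrArg (fun p => p.1) (h' x y z)).symm
      · exact congrArg (fun p => p.2.1) (h' x y z)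
      · exact congrArg (fun p => p.2.2) (h' x y z)
    · rintro ⟨a, b, c⟩
      funext ⟨x, y, z⟩
      exact Prod.ext (a x y z).symm (Prod.ext (b x y z) (c x y z))
  have hl : CondL1 r → CondLR3 r ∧ CondR1 r := fun h => aux_l1 h1 li h
  have hrr : CondR1 r → CondL1 r := fun h => by
    have := (aux_l1 (l := fun x y => ract r y x) (s := fun x y => lact r y x)
      (fun x y => h2 y x) si (fun x y z => h z y x)).2
    exact fun x y z => this z y x
  have h3l : CondLR3 r → CondL1 r := fun h => aux_lr3 h1 li ls si sq sq' h
  have hall : CondL1 r → IsCyclic r ∧ CondLRI r := by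
    intro h
    obtain ⟨a1, cl1⟩ := aux_lri h1 li sq h
    obtain ⟨b1, cr1⟩ := aux_lri (l := fun x y => ract r y x) (s := fun x y => lact r y x)
      (fun x y => h2 y x) si sq' (fun x y z => (hl h).2 z y x)
    have a2 : ∀ x y, ract r (lact r y x) y = x := fun x y => li y _ _ (a1 _ _)
    refine ⟨⟨fun x y => cl1 y x, fun x y => cr1 y x, fun x y => ?_, fun x y => ?_⟩,
      fun x y => ⟨a2 y x, a1 y x⟩⟩
    · have := cl1 (lact r x y) x
      rw [a2] at this
      exact this.symm
    · have := cr1 (ract r y x) x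
      simp only [a1] at this
      exact this.symm
  have hcs : CondL1 r → CondCSL r := fun h => by
    obtain ⟨⟨_, _, c, _⟩, d⟩ := hall h
    exact (aux_csl (fun x y => (d y x).2) (fun x y => (d y x).1) c).2 (hl h).2
  have hcr : CondCSL r → CondR1 r := fun h => by
    have c : ∀ x y, lact r (lact r x y) x = lact r y x := fun x y => by
      have := h x y x
      rw [sq, sq] at this
      exact this.symm
    have a1 := aux_csl_lri h1 li ls c
    exact (aux_csl a1 (fun x y => li y _ _ (a1 _ _)) c).1 h
  have hl2 : CondL2 r ↔ CondL1 r ∧ CondLR3 r := by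
    constructor
    · intro h
      exact ⟨fun x y z => (congrArg Prod.fst (h x y z)).symm,
        fun x y z => congrArg Prod.snd (h x y z)⟩
    · rintro ⟨a, b⟩ x y z
      exact Prod.ext (a x y z).symm (b x y z)
  have hr2 : CondR2 r ↔ CondLR3 r ∧ CondR1 r := by
    constructor
    · intro h
      exact ⟨fun x y z => (congrArg Prod.fst (h x y z)).symm,
        fun x y z => (congrArg Prod.snd (h x y z)).symm⟩
    · rintro ⟨a, b⟩ x y z
      exact Prod.ext (a x y z).symm (b x y z).symm
  refine ⟨?_, fun h => hall (hB.1 h).1⟩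
  tfae_have 1 ↔ 2 := ⟨fun h => (hB.1 h).1, fun h => hB.2 ⟨h, hl h⟩⟩
  tfae_have 3 ↔ 2 := ⟨fun h => (hl2.1 h).1, fun h => hl2.2 ⟨h, (hl h).1⟩⟩
  tfae_have 4 ↔ 2 := ⟨hrr, fun h => (hl h).2⟩
  tfae_have 5 ↔ 2 := ⟨fun h => hrr (hr2.1 h).2, fun h => hr2.2 (hl h)⟩
  tfae_have 6 ↔ 2 := ⟨h3l, fun h => (hl h).1⟩
  tfae_have 7 ↔ 2 := ⟨fun h => hrr (hcr h), hcs⟩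
  tfae_finish

end YB
end

section
/- Let S be an M3-monoid which, as a monoid, is left cancellative. Then its associated map r_S(u,v) = (^u v, u^v) satisfies the Yang–Baxter equation on S×S×S. In particular, a left cancellative M3-monoid whose associated map r_S is bijective is a braided monoid. -/
/- Common framework for set-theoretic solutions of the Yang-Baxter equation
   (quadratic sets), following Gateva-Ivanova & Majid. -/

namespace YB

variable {X Y : Type*}

/-- Proposition 3.9: the associated map of a left cancellative
M3-monoid obeys the YBE; in particular if it is bijective the monoid is a
braided monoid. -/
theorem m3_left_cancellative_braided {S : Type*} [Monoid S] (M : M3Structure S)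
    (hc : ∀ a b c : S, a * b = a * c → b = c) :
    IsBraided M.map ∧
      (Function.Bijective M.map →
        Function.Bijective M.map ∧ IsBraided M.map) := by
  have h1 : ∀ x y z : S, M.lact (M.lact x y) (M.lact (M.ract x y) z)
      = M.lact x (M.lact y z) := by
    intro x y z
    rw [← M.mul_lact, M.m3, M.mul_lact]
  have h3 : ∀ x y z : S, M.ract (M.ract x y) z
      = M.ract (M.ract x (M.lact y z)) (M.ract y z) := by
    intro x y z
    rw [← M.ract_mul, ← M.ract_mul, M.m3]
  have h2 : ∀ x y z : S, M.ract (M.lact x y) (M.lact (M.ract x y) z)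
      = M.lact (M.ract x (M.lact y z)) (M.ract y z) := by
    intro x y z
    apply hc (M.lact x (M.lact y z))
    rw [← M.lact_mul, M.m3, ← h1, M.m3, ← M.lact_mul]
  have hb : IsBraided M.map := by
    funext p
    obtain ⟨x, y, z⟩ := p
    exact Prod.ext (h1 x y z) (Prod.ext (h2 x y z) (h3 x y z))
  exact ⟨hb, fun h => ⟨h, hb⟩⟩

end YB
end
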